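/- Fix a constant δ > 0 and suppose n ≥ n₀(δ) and k' ≤ n^{1−δ}. Suppose also min{k, k'} ≥ (k/λ)·√(k'/n) and λ ≤ min{ n^{−δ}·(k/2)·√(k'/n), (1/(4e))·(n/k')^{1/2−δ} }. Then for any β satisfying 0 ≤ β ≤ (log 2 / 16)·n^{−δ}·min{ k/λ, n/(2eλk') }, there exists ℓ satisfying max{n^δ, 2e·k·(k'/n)^{1−δ}} ≤ ℓ ≤ (k/(2λ))·√(k'/n) ≤ (1/2)·min{k, k'} such that, with probability at least 1 − 2^{−(ℓ−2)/2} ≥ 1 − 2^{−(n^δ−2)/2} over W ∼ GOE(n), D_{β,ℓ} ≥ (log 2 / 8)·min{ (log 2 / 8)·k/(βλ), (k/λ)·√(k'/n) } − log 2. -/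

import Mathlib

open MeasureTheory ProbabilityTheory Filter Asymptotics

noncomputable def goeMeasure (n : ℕ) : Measure (Fin n → Fin n → ℝ) :=
  Measure.map (fun g i j => g (min i j, max i j))
    (Measure.pi fun p : Fin n × Fin n =>
      gaussianReal 0 (if p.1 = p.2 then 2 / (n : NNReal) else 1 / (n : NNReal)))

noncomputable def quadForm {n : ℕ} (Y : Fin n → Fin n → ℝ) (S : Finset (Fin n)) : ℝ :=
  ∑ i ∈ S, ∑ j ∈ S, Y i j

noncomputable def Ymat {n : ℕ} (k : ℕ) (lam : ℝ) (x : Finset (Fin n))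
    (W : Fin n → Fin n → ℝ) : Fin n → Fin n → ℝ :=
  fun i j => lam / k * ((if i ∈ x then (1 : ℝ) else 0) * (if j ∈ x then (1 : ℝ) else 0)) + W i j

open Classical in
noncomputable def regionSum {n : ℕ} (k' : ℕ) (β : ℝ) (Y : Fin n → Fin n → ℝ)
    (P : Finset (Fin n) → Prop) : ℝ :=
  ∑ S ∈ Finset.univ.filter (fun S : Finset (Fin n) => S.card = k' ∧ P S),
    Real.exp (β * quadForm Y S)

noncomputable def gibbsProb {n : ℕ} (k' : ℕ) (β : ℝ) (Y : Fin n → Fin n → ℝ)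
    (P : Finset (Fin n) → Prop) : ℝ :=
  regionSum k' β Y P / regionSum k' β Y fun _ => True

noncomputable def FEWdepthY {n : ℕ} (k' : ℕ) (β ℓ : ℝ) (x : Finset (Fin n))
    (Y : Fin n → Fin n → ℝ) : ℝ :=
  Real.log (gibbsProb k' β Y fun S => ((x ∩ S).card : ℝ) < ℓ) -
    Real.log (gibbsProb k' β Y fun S => ℓ ≤ ((x ∩ S).card : ℝ) ∧ ((x ∩ S).card : ℝ) ≤ 2 * ℓ)

noncomputable def FEWdepth {n : ℕ} (k k' : ℕ) (lam β ℓ : ℝ) (x : Finset (Fin n))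
    (W : Fin n → Fin n → ℝ) : ℝ :=
  FEWdepthY k' β ℓ x (Ymat k lam x W)

noncomputable def phiVal {n : ℕ} (k' ℓ : ℕ) (Y : Fin n → Fin n → ℝ) (x : Finset (Fin n)) : ℝ :=
  sInf {r : ℝ | ∃ S : Finset (Fin n), S.card = k' ∧ (x ∩ S).card = ℓ ∧ r = -quadForm Y S}

noncomputable def gammaCurve (n k k' : ℕ) (lam : ℝ) (ℓ : ℕ) : ℝ :=
  -(lam * (ℓ : ℝ) ^ 2 / k) -
    2 * k' * Real.sqrt (1 / (n : ℝ) *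
      Real.log ((k.choose ℓ : ℝ) * ((n - k).choose (k' - ℓ) : ℝ)))

noncomputable def ellCrit (n k k' : ℕ) (lam : ℝ) : ℝ :=
  1 / (2 * lam) * k * Real.sqrt ((k' : ℝ) / ((n : ℝ) * Real.log ((n : ℝ) / (k' : ℝ)))) *
    Real.log (1 / (2 * lam) * Real.sqrt ((n : ℝ) / ((k' : ℝ) * Real.log ((n : ℝ) / (k' : ℝ)))))

def AssumLambda (k : ℕ → ℕ) (lam : ℕ → ℝ) : Prop :=
  ((fun n => (k n : ℝ) / n * Real.log ((n : ℝ) / (k n : ℝ))) =o[atTop] lam) ∧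
    (lam =o[atTop] fun n => min 1 ((k n : ℝ) / (Real.sqrt n * Real.log n)))

def AssumKprime (k k' : ℕ → ℕ) (lam : ℕ → ℝ) : Prop :=
  ((fun n => (k n : ℝ) ^ 2 / (lam n ^ 2 * n) * (Real.log ((n : ℝ) / (k n : ℝ))) ^ 2 /
      Real.log (lam n * n / (k n * Real.log ((n : ℝ) / (k n : ℝ))))) =o[atTop]
    fun n => (k' n : ℝ)) ∧
  ((fun n => (k' n : ℝ)) =o[atTop] fun n => lam n ^ 2 * n / Real.log n ^ 3) ∧
  ((fun n => (k' n : ℝ)) =o[atTop]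
    fun n => ((k n : ℝ) ^ 2 * n / (lam n ^ 2 * Real.log n)) ^ ((1 : ℝ) / 3))

def hasOGP {n : ℕ} (k k' : ℕ) (Y : Fin n → Fin n → ℝ) (x : Finset (Fin n)) (ζ₁ ζ₂ : ℕ) : Prop :=
  ζ₁ ≤ min k k' ∧ ζ₂ ≤ min k k' ∧ ζ₁ + 2 < ζ₂ ∧
    ∃ r : ℝ,
      (∃ v w : Finset (Fin n), v.card = k' ∧ w.card = k' ∧
        (x ∩ v).card ≤ ζ₁ ∧ ζ₂ ≤ (x ∩ w).card ∧ -quadForm Y v ≤ r ∧ -quadForm Y w ≤ r) ∧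
      ∀ v : Finset (Fin n), v.card = k' → -quadForm Y v ≤ r →
        (x ∩ v).card ≤ ζ₁ ∨ ζ₂ ≤ (x ∩ v).card


theorem goe_perm (n : ℕ) (σ : Equiv.Perm (Fin n)) :
    Measure.map (fun (W : Fin n → Fin n → ℝ) i j => W (σ i) (σ j)) (goeMeasure n) = goeMeasure n := by
  classical
  let τ : Fin n × Fin n → Fin n × Fin n := fun p =>
    if p.1 ≤ p.2 then (min (σ p.1) (σ p.2), max (σ p.1) (σ p.2))
    else (max (σ p.1) (σ p.2), min (σ p.1) (σ p.2))
  have hinj : Function.Injective τ := by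
    rintro ⟨a, b⟩ ⟨c, d⟩ h
    have e : ∀ u v, σ u = σ v ↔ u = v := fun u v => σ.injective.eq_iff
    simp only [τ] at h
    have e1 := e a c
    have e2 := e a d
    have e3 := e b c
    have e4 := e b d
    have e5 := e a b
    have e6 := e c d
    ext1
    all_goals
      rcases le_total (σ a) (σ b) with h1 | h1 <;> rcases le_total (σ c) (σ d) with h2 | h2 <;>
      split_ifs at h <;> simp only [min_eq_left, min_eq_right, max_eq_left, max_eq_right, h1, h2, Prod.mk.injEq] at h ⊢ <;> grind
  let e : (Fin n × Fin n) ≃ (Fin n × Fin n) := Equiv.ofBijective τ (Finite.injective_iff_bijective.mp hinj)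
  have hdiag : ∀ p, (e p).1 = (e p).2 ↔ p.1 = p.2 := by
    intro p
    have e5 := σ.injective.eq_iff (a := p.1) (b := p.2)
    show (τ p).1 = (τ p).2 ↔ _
    simp only [τ]
    split_ifs <;> simp only [← e5] <;> rcases le_total (σ p.1) (σ p.2) with h1 | h1 <;> simp [h1] <;> exact eq_comm
  set ν : Fin n × Fin n → Measure ℝ := fun p =>
      gaussianReal 0 (if p.1 = p.2 then 2 / (n : NNReal) else 1 / (n : NNReal)) with hν
  have hνe : (fun p => ν (e p)) = ν := by
    funext p; simp only [hν, hdiag]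
  have hmp := measurePreserving_piCongrLeft ν e.symm
  have hνe' : (fun p => ν (e.symm p)) = ν := by
    funext p
    have := congrFun hνe (e.symm p)
    simpa using this.symm
  rw [hνe'] at hmp
  have hm : Measurable (fun (g : Fin n × Fin n → ℝ) (i j : Fin n) => g (min i j, max i j)) := by
    fun_prop
  have hm2 : Measurable (fun (W : Fin n → Fin n → ℝ) (i j : Fin n) => W (σ i) (σ j)) := by
    fun_prop
  unfold goeMeasure
  rw [Measure.map_map hm2 hm]
  change _ = Measure.map _ (Measure.pi ν)
  conv_rhs => rw [← hmp.map_eq, Measure.map_map hm (MeasurableEquiv.measurable _)]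
  congr 1
  funext g i j
  simp only [Function.comp]
  have : (MeasurableEquiv.piCongrLeft (fun _ : Fin n × Fin n => ℝ) e.symm) g (min i j, max i j)
      = g (e (min i j, max i j)) := by
    have := Equiv.piCongrLeft_apply_apply (fun _ : Fin n × Fin n => ℝ) e.symm g (e (min i j, max i j))
    rw [MeasurableEquiv.coe_piCongrLeft]
    simpa using this
  rw [this]
  congr 1
  show _ = τ _
  simp only [τ]
  rcases le_total i j with h | h <;> simp [h, min_comm, max_comm]

theorem quad_perm {n : ℕ} (σ : Equiv.Perm (Fin n)) (W : Fin n → Fin n → ℝ) (S : Finset (Fin n)) :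
    quadForm (fun i j => W (σ i) (σ j)) S = quadForm W (S.map σ.toEmbedding) := by
  simp [quadForm]

theorem regionSum_perm {n : ℕ} (σ : Equiv.Perm (Fin n)) (k' : ℕ) (β : ℝ) (W : Fin n → Fin n → ℝ) :
    regionSum k' β (fun i j => W (σ i) (σ j)) (fun _ => True) = regionSum k' β W (fun _ => True) := by
  classical
  unfold regionSum
  refine Finset.sum_bij (fun S _ => S.map σ.toEmbedding) ?_ ?_ ?_ ?_
  · intro S hS; simpa using hS
  · intro S _ T _ h; exact Finset.map_injective _ h
  · intro T hT
    refine ⟨T.map σ.symm.toEmbedding, by simpa using hT, ?_⟩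
    ext i; simp
  · intro S _; rw [quad_perm]

theorem meas_quad {n : ℕ} (S : Finset (Fin n)) :
    Measurable (fun W : Fin n → Fin n → ℝ => quadForm W S) := by
  unfold quadForm; fun_prop

theorem meas_region {n : ℕ} (k' : ℕ) (β : ℝ) (P : Finset (Fin n) → Prop) :
    Measurable (fun W : Fin n → Fin n → ℝ => regionSum k' β W P) := by
  unfold regionSum
  refine Finset.measurable_sum _ fun S _ => ?_
  exact Real.measurable_exp.comp ((meas_quad S).const_mul β)

instance goe_prob (n : ℕ) : IsProbabilityMeasure (goeMeasure n) := by
  unfold goeMeasure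
  apply Measure.isProbabilityMeasure_map
  exact Measurable.aemeasurable (by fun_prop)

theorem region_nonneg {n : ℕ} (k' : ℕ) (β : ℝ) (W : Fin n → Fin n → ℝ) (P : Finset (Fin n) → Prop) :
    0 ≤ regionSum k' β W P := Finset.sum_nonneg fun _ _ => (Real.exp_pos _).le

theorem region_pos {n : ℕ} (k' : ℕ) (β : ℝ) (W : Fin n → Fin n → ℝ) (P : Finset (Fin n) → Prop)
    (S : Finset (Fin n)) (hS : S.card = k') (hP : P S) : 0 < regionSum k' β W P := by
  classical
  exact Finset.sum_pos (fun _ _ => Real.exp_pos _) ⟨S, by simp [hS, hP]⟩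

noncomputable def wt {n : ℕ} (k' : ℕ) (β : ℝ) (S : Finset (Fin n)) (W : Fin n → Fin n → ℝ) : ℝ :=
  Real.exp (β * quadForm W S) / regionSum k' β W (fun _ => True)

theorem wt_meas {n : ℕ} (k' : ℕ) (β : ℝ) (S : Finset (Fin n)) : Measurable (wt k' β S) :=
  (Real.measurable_exp.comp ((meas_quad S).const_mul β)).div (meas_region k' β _)

theorem wt_nonneg {n : ℕ} (k' : ℕ) (β : ℝ) (S : Finset (Fin n)) (W) : 0 ≤ wt k' β S W :=
  div_nonneg (Real.exp_pos _).le (region_nonneg _ _ _ _)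

theorem wt_le_one {n : ℕ} (k' : ℕ) (β : ℝ) (S : Finset (Fin n)) (hS : S.card = k') (W) :
    wt k' β S W ≤ 1 := by
  classical
  refine div_le_one_of_le₀ ?_ (region_nonneg _ _ _ _)
  exact Finset.single_le_sum (f := fun S => Real.exp (β * quadForm W S))
    (fun _ _ => (Real.exp_pos _).le) (by simp [hS])

theorem wt_int {n : ℕ} (k' : ℕ) (β : ℝ) (S : Finset (Fin n)) (hS : S.card = k') :
    Integrable (wt k' β S) (goeMeasure n) := by
  refine Integrable.of_bound (wt_meas k' β S).aestronglyMeasurable 1 (ae_of_all _ fun W => ?_)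
  rw [Real.norm_eq_abs, abs_of_nonneg (wt_nonneg _ _ _ _)]
  exact wt_le_one _ _ _ hS _

theorem wt_integral_eq {n : ℕ} (k' : ℕ) (β : ℝ) (S T : Finset (Fin n)) (hS : S.card = k')
    (hT : T.card = k') : ∫ W, wt k' β S W ∂(goeMeasure n) = ∫ W, wt k' β T W ∂(goeMeasure n) := by
  classical
  obtain ⟨σ, hσ⟩ : ∃ σ : Equiv.Perm (Fin n), S.map σ.toEmbedding = T := by
    have e1 : S ≃ T := Finset.equivOfCardEq (hS.trans hT.symm)
    let σ := e1.extendSubtype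
    refine ⟨σ, Finset.eq_of_subset_of_card_le ?_ (by simp [hS, hT])⟩
    intro i hi
    simp only [Finset.mem_map] at hi
    obtain ⟨j, hj, rfl⟩ := hi
    exact e1.extendSubtype_mem j hj
  conv_lhs => rw [← goe_perm n σ]
  rw [integral_map]
  · congr 1
    funext W
    simp only [wt, regionSum_perm, quad_perm, hσ]
  · exact Measurable.aemeasurable (by fun_prop)
  · exact (wt_meas _ _ _).aestronglyMeasurable

open Classical in
theorem avg {n : ℕ} (k' : ℕ) (hk : k' ≤ n) (β : ℝ) (P : Finset (Fin n) → Prop) :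
    Integrable (fun W => regionSum k' β W P / regionSum k' β W (fun _ => True)) (goeMeasure n) ∧
    ∫ W, regionSum k' β W P / regionSum k' β W (fun _ => True) ∂(goeMeasure n) =
      ((Finset.univ.filter (fun S : Finset (Fin n) => S.card = k' ∧ P S)).card : ℝ) / n.choose k' := by
  obtain ⟨S0, hS0⟩ : ∃ S : Finset (Fin n), S.card = k' := by
    obtain ⟨S, -, h⟩ := Finset.exists_subset_card_eq (s := (Finset.univ : Finset (Fin n))) (n := k') (by simpa using hk)
    exact ⟨S, h⟩
  have key : ∀ Q : Finset (Fin n) → Prop, ∀ W, regionSum k' β W Q / regionSum k' β W (fun _ => True) =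
      ∑ S ∈ Finset.univ.filter (fun S : Finset (Fin n) => S.card = k' ∧ Q S), wt k' β S W := by
    intro Q W
    simp only [wt, ← Finset.sum_div]; rfl
  have hintg : ∀ Q : Finset (Fin n) → Prop, ∫ W, regionSum k' β W Q / regionSum k' β W (fun _ => True) ∂(goeMeasure n)
     = ((Finset.univ.filter (fun S : Finset (Fin n) => S.card = k' ∧ Q S)).card : ℝ) * ∫ W, wt k' β S0 W ∂(goeMeasure n) := by
    intro Q
    simp only [key]
    rw [integral_finsetSum]
    · rw [Finset.sum_congr rfl (fun S hS => wt_integral_eq k' β S S0 (by simp at hS; exact hS.1) hS0)]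
      simp
    · intro S hS; exact wt_int _ _ _ (by simp at hS; exact hS.1)
  constructor
  · simp only [key]
    exact integrable_finsetSum _ fun S hS => wt_int _ _ _ (by simp at hS; exact hS.1)
  · have h1 := hintg (fun _ => True)
    have h2 : ∀ W : Fin n → Fin n → ℝ, regionSum k' β W (fun _ => True) / regionSum k' β W (fun _ => True) = 1 :=
      fun W => div_self (region_pos k' β W _ S0 hS0 trivial).ne'
    simp only [h2] at h1
    have h3 : (Finset.univ.filter (fun S : Finset (Fin n) => S.card = k' ∧ True)).card = n.choose k' := by
      have h4 : (Finset.univ.filter (fun S : Finset (Fin n) => S.card = k' ∧ True)) =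
          (Finset.univ : Finset (Fin n)).powersetCard k' := by
        ext S; simp
      rw [h4]; simp
    have h1 : (1 : ℝ) = (n.choose k' : ℝ) * ∫ W, wt k' β S0 W ∂(goeMeasure n) := by
      rw [← h3]; simpa using h1
    rw [hintg, div_eq_mul_inv]
    congr 1
    exact eq_inv_of_mul_eq_one_right h1.symm

open Classical in
theorem count {n : ℕ} (k' m : ℕ) (hmk : m ≤ k') (x : Finset (Fin n)) :
    (Finset.univ.filter (fun S : Finset (Fin n) => S.card = k' ∧ m ≤ (x ∩ S).card)).card
      ≤ x.card.choose m * (n - m).choose (k' - m) := by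
  calc _ ≤ ((x.powersetCard m).biUnion fun T => ((Finset.univ \ T).powersetCard (k' - m)).image (fun R => T ∪ R)).card := by
        apply Finset.card_le_card
        intro S hS
        simp only [Finset.mem_filter, Finset.mem_univ, true_and] at hS
        obtain ⟨T, hT, hTc⟩ := Finset.exists_subset_card_eq hS.2
        have hTS : T ⊆ S := hT.trans Finset.inter_subset_right
        simp only [Finset.mem_biUnion, Finset.mem_powersetCard, Finset.mem_image]
        refine ⟨T, ⟨hT.trans Finset.inter_subset_left, hTc⟩, S \ T, ⟨?_, ?_⟩, ?_⟩
        · exact Finset.sdiff_subset_sdiff (Finset.subset_univ _) le_rfl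
        · rw [Finset.card_sdiff_of_subset hTS]; omega
        · exact Finset.union_sdiff_of_subset hTS
    _ ≤ (x.powersetCard m).card * (n - m).choose (k' - m) := by
        apply Finset.card_biUnion_le_card_mul
        intro T hT
        refine Finset.card_image_le.trans ?_
        rw [Finset.card_powersetCard, Finset.card_sdiff_of_subset (Finset.subset_univ _)]
        simp [(Finset.mem_powersetCard.mp hT).2]
    _ = _ := by rw [Finset.card_powersetCard]

theorem desc_le (a n m : ℕ) (h : a ≤ n) : a.descFactorial m * n ^ m ≤ n.descFactorial m * a ^ m := by
  induction m with
  | zero => simp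
  | succ m ih =>
    rw [Nat.descFactorial_succ, Nat.descFactorial_succ, pow_succ, pow_succ]
    have : (a - m) * n ≤ (n - m) * a := by
      rw [Nat.sub_mul, Nat.sub_mul, mul_comm a n]
      exact Nat.sub_le_sub_left (Nat.mul_le_mul_left _ h) _
    calc _ = (a.descFactorial m * n ^ m) * ((a - m) * n) := by ring
      _ ≤ (n.descFactorial m * a ^ m) * ((n - m) * a) := Nat.mul_le_mul ih this
      _ = _ := by ring

theorem ratio_bound (n k k' m : ℕ) (hmk : m ≤ k') (hk : k' ≤ n) (hm : 0 < m) 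
    (hb : 2 * Real.exp 1 * k * (k' / n : ℝ) ≤ m) :
    ((k.choose m * (n - m).choose (k' - m) : ℕ) : ℝ) / n.choose k' ≤ (1/2) ^ m := by
  have hn : (0:ℝ) < n := by exact_mod_cast (by omega : 0 < n)
  have h1 := Nat.choose_mul (n := n) (k := k') (s := m) hmk
  have h1' : (n.choose k' : ℝ) * k'.choose m = n.choose m * (n-m).choose (k'-m) := by exact_mod_cast h1
  have p1 : (0:ℝ) < n.choose k' := by exact_mod_cast Nat.choose_pos hk
  have p2 : (0:ℝ) < n.choose m := by exact_mod_cast Nat.choose_pos (hmk.trans hk)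
  have h2 : (k'.choose m : ℝ) * n ^ m ≤ n.choose m * k' ^ m := by
    have := desc_le k' n m hk
    rw [Nat.descFactorial_eq_factorial_mul_choose, Nat.descFactorial_eq_factorial_mul_choose, mul_assoc, mul_assoc] at this
    exact_mod_cast Nat.le_of_mul_le_mul_left this (Nat.factorial_pos m)
  have h3 : ((n-m).choose (k'-m) : ℝ) / n.choose k' ≤ (k'/n) ^ m := by
    rw [div_pow, div_le_div_iff₀ p1 (by positivity)]
    refine le_of_mul_le_mul_left ?_ p2
    calc _ = (n.choose k' : ℝ) * (k'.choose m * n ^ m) := by rw [← mul_assoc, ← h1', mul_assoc]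
      _ ≤ (n.choose k' : ℝ) * (n.choose m * k' ^ m) := by gcongr
      _ = _ := by ring
  have h4 : (k.choose m : ℝ) ≤ k ^ m / m.factorial := Nat.choose_le_pow_div m k
  have h5 : (m:ℝ) ^ m / m.factorial ≤ Real.exp 1 ^ m := by
    rw [← Real.exp_nat_mul, mul_one]
    exact Real.pow_div_factorial_le_exp _ (by positivity) m
  have hm' : (0:ℝ) < m := by exact_mod_cast hm
  calc _ = (k.choose m : ℝ) * (((n-m).choose (k'-m) : ℝ) / n.choose k') := by push_cast; ring
    _ ≤ (k ^ m / m.factorial) * (k'/n) ^ m := by gcongr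
    _ = (m ^ m / m.factorial) * (k * (k'/n) / m) ^ m := by
        rw [div_pow _ (m:ℝ), mul_pow]; field_simp
    _ ≤ Real.exp 1 ^ m * (k * (k'/n) / m) ^ m := by gcongr
    _ = (Real.exp 1 * (k * (k'/n) / m)) ^ m := by rw [mul_pow]
    _ ≤ _ := by
      gcongr
      rw [← mul_div_assoc, div_le_iff₀ hm']
      linarith

theorem quad_Ymat {n : ℕ} (k : ℕ) (lam : ℝ) (x S : Finset (Fin n)) (W : Fin n → Fin n → ℝ) :
    quadForm (Ymat k lam x W) S = lam / k * ((x ∩ S).card : ℝ) ^ 2 + quadForm W S := by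
  classical
  unfold quadForm Ymat
  simp only [Finset.sum_add_distrib, ← Finset.mul_sum]
  congr 2
  simp only [← Finset.sum_mul, Finset.sum_boole]
  rw [← sq, Finset.filter_mem_eq_inter, Finset.inter_comm]

theorem det_bound {n : ℕ} (k k' : ℕ) (lam β ℓ : ℝ) (x S0 : Finset (Fin n)) (W : Fin n → Fin n → ℝ)
    (hℓ : 2 ≤ ℓ) (hlam : 0 < lam) (hk : 0 < k) (hβ : 0 ≤ β)
    (hsig : β * lam * 16 * ℓ ≤ Real.log 2 * k)
    (hS0 : S0.card = k') (hS1 : ℓ ≤ ((x ∩ S0).card : ℝ)) (hS2 : ((x ∩ S0).card : ℝ) ≤ 2 * ℓ)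
    (hq : regionSum k' β W (fun S => ℓ ≤ ((x ∩ S).card : ℝ)) / regionSum k' β W (fun _ => True)
      < (2 : ℝ) ^ (-ℓ / 2)) :
    Real.log 2 / 4 * ℓ - Real.log 2 ≤ FEWdepth k k' lam β ℓ x W := by
  classical
  set Y := Ymat k lam x W with hY
  set Z := regionSum k' β W (fun _ => True) with hZ
  set Zg := regionSum k' β W (fun S => ℓ ≤ ((x ∩ S).card : ℝ)) with hZg
  set Zl := regionSum k' β W (fun S => ((x ∩ S).card : ℝ) < ℓ) with hZl
  set RA := regionSum k' β Y (fun S => ((x ∩ S).card : ℝ) < ℓ) with hRA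
  set RB := regionSum k' β Y (fun S => ℓ ≤ ((x ∩ S).card : ℝ) ∧ ((x ∩ S).card : ℝ) ≤ 2 * ℓ) with hRB
  have hZpos : 0 < Z := region_pos _ _ _ _ S0 hS0 trivial
  have hRpos : 0 < regionSum k' β Y (fun _ => True) := region_pos _ _ _ _ S0 hS0 trivial
  have hRBpos : 0 < RB := region_pos _ _ _ _ S0 hS0 ⟨hS1, hS2⟩
  have hsum : Z = Zl + Zg := by
    simp only [hZ, hZl, hZg, regionSum]
    rw [← Finset.sum_filter_add_sum_filter_not _ (fun S : Finset (Fin n) => ((x ∩ S).card : ℝ) < ℓ)]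
    simp only [Finset.filter_filter, and_true, not_lt]
  have hk' : (0:ℝ) < k := by exact_mod_cast hk
  have hlog2 : 0 < Real.log 2 := Real.log_pos (by norm_num)
  have hA : Zl ≤ RA := by
    refine Finset.sum_le_sum fun S _ => Real.exp_le_exp.mpr ?_
    rw [hY, quad_Ymat]
    have : 0 ≤ lam / k * ((x ∩ S).card : ℝ) ^ 2 := by positivity
    exact mul_le_mul_of_nonneg_left (by linarith) hβ
  have hB : RB ≤ Real.exp (Real.log 2 / 4 * ℓ) * Zg := by
    simp only [hRB, hZg, regionSum]
    rw [Finset.mul_sum]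
    refine (Finset.sum_le_sum (g := fun S => Real.exp (Real.log 2 / 4 * ℓ) * Real.exp (β * quadForm W S)) ?_).trans
      (Finset.sum_le_sum_of_subset_of_nonneg ?_ ?_)
    · intro S hS
      simp only [Finset.mem_filter, Finset.mem_univ, true_and] at hS
      rw [← Real.exp_add]
      refine Real.exp_le_exp.mpr ?_
      rw [hY, quad_Ymat, mul_add]
      have h1 : ((x ∩ S).card : ℝ) ^ 2 ≤ (2 * ℓ) ^ 2 := by
        gcongr; exact hS.2.2
      have h2 : β * (lam / k * ((x ∩ S).card : ℝ) ^ 2) ≤ β * (lam / k * (2 * ℓ) ^ 2) := by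
        gcongr
      have h3 : β * (lam / k * (2 * ℓ) ^ 2) ≤ Real.log 2 / 4 * ℓ := by
        have : β * (lam / k * (2 * ℓ) ^ 2) = (β * lam * 16 * ℓ) * ℓ / (4 * k) := by
          field_simp; ring
        rw [this, div_le_iff₀ (by positivity)]
        have := mul_le_mul_of_nonneg_right hsig (by linarith : (0:ℝ) ≤ ℓ)
        linarith
      linarith
    · intro S hS
      simp only [Finset.mem_filter, Finset.mem_univ, true_and] at hS ⊢
      exact ⟨hS.1, hS.2.1⟩
    · intro S _ _; positivity
  have ht : (2 : ℝ) ^ (-ℓ / 2) = Real.exp (-(Real.log 2 / 2 * ℓ)) := by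
    rw [Real.rpow_def_of_pos (by norm_num)]; congr 1; ring
  have ht2 : (2 : ℝ) ^ (-ℓ / 2) ≤ 1 / 2 := by
    calc (2 : ℝ) ^ (-ℓ / 2) ≤ (2:ℝ) ^ (-1 : ℝ) := Real.rpow_le_rpow_of_exponent_le (by norm_num) (by linarith)
      _ = _ := by rw [Real.rpow_neg_one]; norm_num
  rw [div_lt_iff₀ hZpos] at hq
  have hRA2 : Z / 2 ≤ RA := by nlinarith
  have hRB2 : RB ≤ Real.exp (-(Real.log 2 / 4 * ℓ)) * Z := by
    calc RB ≤ Real.exp (Real.log 2 / 4 * ℓ) * Zg := hB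
      _ ≤ Real.exp (Real.log 2 / 4 * ℓ) * (Real.exp (-(Real.log 2 / 2 * ℓ)) * Z) := by
        rw [← ht]; gcongr
      _ = _ := by rw [← mul_assoc, ← Real.exp_add]; congr 2; ring
  have hRApos : 0 < RA := by linarith
  have e1 : FEWdepth k k' lam β ℓ x W = Real.log RA - Real.log RB := by
    unfold FEWdepth FEWdepthY gibbsProb
    rw [Real.log_div hRApos.ne' hRpos.ne', Real.log_div hRBpos.ne' hRpos.ne']
    ring
  have l1 : Real.log Z - Real.log 2 ≤ Real.log RA := by
    rw [← Real.log_div hZpos.ne' (by norm_num)]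
    exact Real.log_le_log (by positivity) hRA2
  have l2 : Real.log RB ≤ -(Real.log 2 / 4 * ℓ) + Real.log Z := by
    have := Real.log_le_log hRBpos hRB2
    rwa [Real.log_mul (Real.exp_pos _).ne' hZpos.ne', Real.log_exp] at this
  rw [e1]; linarith

theorem prob_bound {n : ℕ} (k k' : ℕ) (lam β ℓ : ℝ) (x : Finset (Fin n)) (hx : x.card = k)
    (hℓ : 2 ≤ ℓ) (hlam : 0 < lam) (hβ : 0 ≤ β)
    (hsig : β * lam * 16 * ℓ ≤ Real.log 2 * k)
    (h2k : 2 * ℓ ≤ k) (h2k' : 2 * ℓ ≤ k') (hkk : k + k' ≤ n)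
    (hb : 2 * Real.exp 1 * k * (k' / n : ℝ) ≤ ℓ) :
    ENNReal.ofReal (1 - (2 : ℝ) ^ (-(ℓ - 2) / 2)) ≤ goeMeasure n {W |
      Real.log 2 / 4 * ℓ - Real.log 2 ≤ FEWdepth k k' lam β ℓ x W} := by
  classical
  set m := ⌈ℓ⌉₊ with hm
  have hm1 : ℓ ≤ m := Nat.le_ceil ℓ
  have hm2 : (m:ℝ) < ℓ + 1 := Nat.ceil_lt_add_one (by linarith)
  have hmk : m ≤ k := by exact_mod_cast (by linarith : (m:ℝ) ≤ k)
  have hmk' : m ≤ k' := by exact_mod_cast (by linarith : (m:ℝ) ≤ k')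
  have hmpos : 0 < m := by exact_mod_cast (by linarith : (0:ℝ) < m)
  obtain ⟨T, hT, hTc⟩ := Finset.exists_subset_card_eq (s := x) (n := m) (by omega)
  obtain ⟨R, hR, hRc⟩ := Finset.exists_subset_card_eq (s := xᶜ) (n := k' - m) (by
    rw [Finset.card_compl, Fintype.card_fin]; omega)
  have hxR : Disjoint x R := (disjoint_compl_right (a := x)).mono_right hR
  have hTR : Disjoint T R := hxR.mono_left hT
  have hc : (T ∪ R).card = k' := by rw [Finset.card_union_of_disjoint hTR]; omega
  have hi : x ∩ (T ∪ R) = T := by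
    rw [Finset.inter_union_distrib_left, Finset.inter_eq_right.mpr hT,
      Finset.disjoint_iff_inter_eq_empty.mp hxR, Finset.union_empty]
  set q : (Fin n → Fin n → ℝ) → ℝ := fun W =>
    regionSum k' β W (fun S => ℓ ≤ ((x ∩ S).card : ℝ)) / regionSum k' β W (fun _ => True) with hq
  set t : ℝ := (2 : ℝ) ^ (-ℓ / 2) with ht
  have htpos : 0 < t := Real.rpow_pos_of_pos (by norm_num) _
  have hsub : {W | q W < t} ⊆ {W | Real.log 2 / 4 * ℓ - Real.log 2 ≤ FEWdepth k k' lam β ℓ x W} := by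
    intro W hW
    exact det_bound k k' lam β ℓ x (T ∪ R) W hℓ hlam (by omega) hβ hsig hc
      (by rw [hi, hTc]; exact hm1) (by rw [hi, hTc]; linarith) hW
  refine le_trans ?_ (measure_mono hsub)
  obtain ⟨hintg, heq⟩ := avg (n := n) k' (by omega) β (fun S => ℓ ≤ ((x ∩ S).card : ℝ))
  have hE : ∫ W, q W ∂(goeMeasure n) ≤ t * t := by
    rw [heq]
    have hcnt := count k' m hmk' x
    have hf : (Finset.univ.filter (fun S : Finset (Fin n) => S.card = k' ∧ ℓ ≤ ((x ∩ S).card : ℝ))) =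
      (Finset.univ.filter (fun S : Finset (Fin n) => S.card = k' ∧ m ≤ (x ∩ S).card)) := by
      ext S; simp only [Finset.mem_filter, hm, Nat.ceil_le]
    rw [hf]
    have hr := ratio_bound n k k' m hmk' (by omega) hmpos (hb.trans hm1)
    rw [hx] at hcnt
    calc _ ≤ ((k.choose m * (n - m).choose (k' - m) : ℕ) : ℝ) / n.choose k' := by
          gcongr
      _ ≤ (1/2) ^ m := hr
      _ = (2:ℝ) ^ (-(m:ℝ)) := by
          rw [Real.rpow_neg (by norm_num), Real.rpow_natCast]; simp
      _ ≤ (2:ℝ) ^ (-ℓ) := Real.rpow_le_rpow_of_exponent_le (by norm_num) (by linarith)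
      _ = t * t := by rw [ht, ← Real.rpow_add (by norm_num)]; congr 1; ring
  have hqm : Measurable q := (meas_region _ _ _).div (meas_region _ _ _)
  have hmk := mul_meas_ge_le_integral_of_nonneg (μ := goeMeasure n) (f := q)
    (ae_of_all _ fun W => div_nonneg (region_nonneg _ _ _ _) (region_nonneg _ _ _ _)) hintg t
  have hP : (goeMeasure n).real {W | t ≤ q W} ≤ t := by
    exact le_of_mul_le_mul_left (hmk.trans hE) htpos
  have hcompl : {W | q W < t} = {W | t ≤ q W}ᶜ := by ext W; simp
  have hms : MeasurableSet {W | t ≤ q W} := measurableSet_le measurable_const hqm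
  have hreal : 1 - t ≤ (goeMeasure n).real {W | q W < t} := by
    rw [hcompl, probReal_compl_eq_one_sub hms]; linarith
  have htt : t ≤ (2 : ℝ) ^ (-(ℓ - 2) / 2) :=
    Real.rpow_le_rpow_of_exponent_le (by norm_num) (by linarith)
  rw [← ofReal_measureReal]
  exact ENNReal.ofReal_le_ofReal (by linarith)

/-- Corollary: high-temperature depth bound for informative `ℓ`, `k'`.
Fix `δ > 0`; for `n ≥ n₀(δ)`, `k' ≤ n^{1-δ}`, `min{k,k'} ≥ (k/λ)√(k'/n)` and
`λ ≤ min{n^{-δ}(k/2)√(k'/n), (1/(4e))(n/k')^{1/2-δ}}`, for any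
`0 ≤ β ≤ (log 2/16)·n^{-δ}·min{k/λ, n/(2eλk')}` there exists `ℓ` with
`max{n^δ, 2ek(k'/n)^{1-δ}} ≤ ℓ ≤ (k/(2λ))√(k'/n) ≤ (1/2)min{k,k'}` such that,
with probability at least `1 - 2^{-(ℓ-2)/2} ≥ 1 - 2^{-(n^δ-2)/2}` over `W ∼ GOE(n)`,
`D_{β,ℓ} ≥ (log 2/8)·min{(log 2/8)·k/(βλ), (k/λ)√(k'/n)} - log 2`. -/
theorem stmt_3 (δ : ℝ) (hδ : 0 < δ) :
    ∃ n₀ : ℕ, ∀ n : ℕ, n₀ ≤ n → ∀ k k' : ℕ, (k' : ℝ) ≤ (n : ℝ) ^ ((1 : ℝ) - δ) →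
    ∀ x : Finset (Fin n), x.card = k → ∀ lam : ℝ, 0 < lam →
    (k : ℝ) / lam * Real.sqrt ((k' : ℝ) / n) ≤ min (k : ℝ) (k' : ℝ) →
    lam ≤ min ((n : ℝ) ^ (-δ) * ((k : ℝ) / 2) * Real.sqrt ((k' : ℝ) / n))
      (1 / (4 * Real.exp 1) * ((n : ℝ) / (k' : ℝ)) ^ ((1 : ℝ) / 2 - δ)) →
    ∀ β : ℝ, 0 ≤ β →
      β ≤ Real.log 2 / 16 * (n : ℝ) ^ (-δ) *
        min ((k : ℝ) / lam) ((n : ℝ) / (2 * Real.exp 1 * lam * k')) →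
    ∃ ℓ : ℝ,
      max ((n : ℝ) ^ δ) (2 * Real.exp 1 * k * ((k' : ℝ) / n) ^ ((1 : ℝ) - δ)) ≤ ℓ ∧
      ℓ ≤ (k : ℝ) / (2 * lam) * Real.sqrt ((k' : ℝ) / n) ∧
      (k : ℝ) / (2 * lam) * Real.sqrt ((k' : ℝ) / n) ≤ 1 / 2 * min (k : ℝ) (k' : ℝ) ∧
      1 - (2 : ℝ) ^ (-(((n : ℝ) ^ δ) - 2) / 2) ≤ 1 - (2 : ℝ) ^ (-(ℓ - 2) / 2) ∧
      ENNReal.ofReal (1 - (2 : ℝ) ^ (-(ℓ - 2) / 2)) ≤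
        goeMeasure n {W |
          Real.log 2 / 8 *
              min (Real.log 2 / 8 * (k : ℝ) / (β * lam))
                ((k : ℝ) / lam * Real.sqrt ((k' : ℝ) / n)) - Real.log 2 ≤
            FEWdepth k k' lam β ℓ x W} := by
  have hlog2 : 0 < Real.log 2 := Real.log_pos (by norm_num)
  have he := Real.exp_pos 1
  obtain ⟨N, hN⟩ : ∃ N : ℕ, ∀ n : ℕ, N ≤ n → 2 ≤ (n:ℝ) ^ δ := by
    have := ((tendsto_rpow_atTop hδ).comp tendsto_natCast_atTop_atTop).eventually_ge_atTop (2:ℝ)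
    exact eventually_atTop.mp this
  refine ⟨max N 1, ?_⟩
  intro n hn k k' hk' x hx lam hlam hmin hlamle β hβ hβle
  have hnd := hN n (le_trans (le_max_left _ _) hn)
  have hn1 : 1 ≤ n := le_trans (le_max_right _ _) hn
  have hn0 : (0:ℝ) < n := by exact_mod_cast hn1
  obtain ⟨hl1, hl2⟩ := le_min_iff.mp hlamle
  have hndpos : 0 < (n:ℝ) ^ δ := by linarith
  have hneg : (n:ℝ) ^ (-δ) = ((n:ℝ) ^ δ)⁻¹ := Real.rpow_neg hn0.le δ
  set s := Real.sqrt ((k':ℝ)/n) with hs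
  have hs0 : 0 ≤ s := Real.sqrt_nonneg _
  have hkR : (0:ℝ) ≤ k := Nat.cast_nonneg k
  have hspos : 0 < s := by
    rcases hs0.lt_or_eq with h | h
    · exact h
    · rw [← h] at hl1; simp at hl1; linarith
  have hkpos : (0:ℝ) < k := by
    rcases hkR.lt_or_eq with h | h
    · exact h
    · rw [← h] at hl1; simp at hl1; linarith
  have hrpos : 0 < (k':ℝ)/n := Real.sqrt_pos.mp hspos
  have hk'pos : (0:ℝ) < k' := by
    rcases (Nat.cast_nonneg k' : (0:ℝ) ≤ k').lt_or_eq with h | h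
    · exact h
    · rw [← h] at hrpos; simp at hrpos
  have hk'2 : (k':ℝ) * 2 ≤ n := by
    have h1 : (n:ℝ) ^ ((1:ℝ) - δ) * (n:ℝ) ^ δ = n := by
      rw [← Real.rpow_add hn0]; simp
    calc (k':ℝ) * 2 ≤ (n:ℝ) ^ ((1:ℝ) - δ) * (n:ℝ) ^ δ := by gcongr
      _ = n := h1
  set r := (k':ℝ)/n with hr
  have hr1 : r ≤ 1 := by rw [hr, div_le_one hn0]; linarith
  have hrn : (n:ℝ)/k' = r⁻¹ := by rw [hr, inv_div]
  have hsr : s = r ^ ((1:ℝ)/2) := by rw [hs, Real.sqrt_eq_rpow]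
  set L := (k:ℝ) / (2 * lam) * s with hL
  have hL2 : (k:ℝ) / lam * s = 2 * L := by rw [hL]; field_simp
  rw [hL2] at hmin
  obtain ⟨hm1, hm2⟩ := le_min_iff.mp hmin
  have hLn : (n:ℝ) ^ δ ≤ L := by
    rw [hneg] at hl1
    rw [hL, div_mul_eq_mul_div, le_div_iff₀ (by positivity)]
    have : ((n:ℝ) ^ δ)⁻¹ * ((k:ℝ)/2) * s * (2 * (n:ℝ)^δ) = k * s := by field_simp
    have h2 := mul_le_mul_of_nonneg_right hl1 (by positivity : 0 ≤ 2 * (n:ℝ)^δ)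
    linarith
  have hLr : 2 * Real.exp 1 * k * r ^ ((1:ℝ) - δ) ≤ L := by
    rw [hrn, Real.inv_rpow hrpos.le] at hl2
    have hp : 0 < r ^ ((1:ℝ)/2 - δ) := Real.rpow_pos_of_pos hrpos _
    have h3 : lam * (4 * Real.exp 1) * r ^ ((1:ℝ)/2 - δ) ≤ 1 := by
      calc _ ≤ (1 / (4 * Real.exp 1) * (r ^ ((1:ℝ)/2 - δ))⁻¹) * (4 * Real.exp 1) * r ^ ((1:ℝ)/2 - δ) := by gcongr
        _ = 1 := by field_simp
    have h4 : r ^ ((1:ℝ) - δ) = r ^ ((1:ℝ)/2 - δ) * s := by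
      rw [hsr, ← Real.rpow_add hrpos]; congr 1; ring
    rw [h4, hL, div_mul_eq_mul_div, le_div_iff₀ (by positivity)]
    have := mul_le_mul_of_nonneg_right h3 (by positivity : 0 ≤ (k:ℝ) * s)
    linarith
  have hrr : r ≤ r ^ ((1:ℝ) - δ) := by
    conv_lhs => rw [← Real.rpow_one r]
    exact Real.rpow_le_rpow_of_exponent_ge hrpos hr1 (by linarith)
  have hkk : k + k' ≤ n := by
    have h1 : 2 * Real.exp 1 * k * r ≤ L := le_trans (by gcongr) hLr
    have h2 : 4 * Real.exp 1 * k * r ≤ k' := by linarith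
    have h3 : (k':ℝ) = r * n := by rw [hr]; field_simp
    rw [h3] at h2
    have h4 : 4 * Real.exp 1 * k ≤ n := by
      refine le_of_mul_le_mul_right ?_ hrpos
      linarith
    have h5 : (1:ℝ) ≤ Real.exp 1 := Real.one_le_exp (by norm_num)
    have h6 : (k:ℝ) ≤ Real.exp 1 * k := le_mul_of_one_le_left hkR h5
    have : (k:ℝ) + k' ≤ n := by linarith
    exact_mod_cast this
  have main : ∀ ℓ : ℝ, (n:ℝ) ^ δ ≤ ℓ → 2 * Real.exp 1 * k * r ^ ((1:ℝ) - δ) ≤ ℓ → ℓ ≤ L →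
      β * lam * 16 * ℓ ≤ Real.log 2 * k →
      Real.log 2 / 8 * min (Real.log 2 / 8 * (k : ℝ) / (β * lam)) (2 * L) ≤ Real.log 2 / 4 * ℓ →
      ∃ ℓ : ℝ,
      max ((n : ℝ) ^ δ) (2 * Real.exp 1 * k * r ^ ((1 : ℝ) - δ)) ≤ ℓ ∧
      ℓ ≤ L ∧ L ≤ 1 / 2 * min (k : ℝ) (k' : ℝ) ∧
      1 - (2 : ℝ) ^ (-(((n : ℝ) ^ δ) - 2) / 2) ≤ 1 - (2 : ℝ) ^ (-(ℓ - 2) / 2) ∧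
      ENNReal.ofReal (1 - (2 : ℝ) ^ (-(ℓ - 2) / 2)) ≤
        goeMeasure n {W |
          Real.log 2 / 8 *
              min (Real.log 2 / 8 * (k : ℝ) / (β * lam)) (2 * L) - Real.log 2 ≤
            FEWdepth k k' lam β ℓ x W} := by
    intro ℓ h1 h2 h3 h4 h5
    refine ⟨ℓ, max_le h1 h2, h3, by linarith, ?_, ?_⟩
    · have : (2 : ℝ) ^ (-(ℓ - 2) / 2) ≤ (2 : ℝ) ^ (-(((n : ℝ) ^ δ) - 2) / 2) :=
        Real.rpow_le_rpow_of_exponent_le (by norm_num) (by linarith)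
      linarith
    · refine (prob_bound k k' lam β ℓ x hx (by linarith) hlam hβ h4 (by linarith) (by linarith) hkk
        (le_trans (by gcongr) h2)).trans (measure_mono ?_)
      intro W hW
      simp only [Set.mem_ofPred_eq] at hW ⊢
      linarith
  rw [hL2]
  rcases hβ.lt_or_eq with hβ0 | hβ0
  · have hbl : 0 < β * lam := by positivity
    set Q := Real.log 2 / 16 * k / (β * lam) with hQ
    have hQ2 : Real.log 2 / 8 * (k : ℝ) / (β * lam) = 2 * Q := by rw [hQ]; ring
    have hb1 : β ≤ Real.log 2 / 16 * (n : ℝ) ^ (-δ) * (k / lam) :=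
      hβle.trans (by gcongr; exact min_le_left _ _)
    have hb2 : β ≤ Real.log 2 / 16 * (n : ℝ) ^ (-δ) * ((n : ℝ) / (2 * Real.exp 1 * lam * k')) :=
      hβle.trans (by gcongr; exact min_le_right _ _)
    rw [hneg] at hb1 hb2
    have hQ3 : Q * (β * lam) * 16 = Real.log 2 * k := by rw [hQ]; field_simp
    refine main (min Q L) (le_min ?_ hLn) (le_min ?_ hLr) (min_le_right _ _) ?_ ?_
    · rw [hQ, le_div_iff₀ hbl]
      calc (n:ℝ) ^ δ * (β * lam) ≤ (n:ℝ) ^ δ * ((Real.log 2 / 16 * ((n : ℝ) ^ δ)⁻¹ * (k / lam)) * lam) := by gcongr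
        _ = _ := by field_simp
    · have h1 : r ^ ((1:ℝ) - δ) ≤ r * (n:ℝ) ^ δ := by
        rw [Real.rpow_sub hrpos, Real.rpow_one, div_eq_mul_inv, ← Real.inv_rpow hrpos.le, ← hrn]
        gcongr
        rw [div_le_iff₀ hk'pos]
        have : (1:ℝ) ≤ k' := by
          have : 0 < k' := by exact_mod_cast hk'pos
          exact_mod_cast this
        exact le_mul_of_one_le_right hn0.le this
      rw [hQ, le_div_iff₀ hbl]
      calc 2 * Real.exp 1 * k * r ^ ((1:ℝ) - δ) * (β * lam)
          ≤ 2 * Real.exp 1 * k * (r * (n:ℝ) ^ δ) * ((Real.log 2 / 16 * ((n : ℝ) ^ δ)⁻¹ * ((n : ℝ) / (2 * Real.exp 1 * lam * k'))) * lam) := by gcongr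
        _ = _ := by rw [hr]; field_simp
    · have : β * lam * 16 * min Q L ≤ β * lam * 16 * Q := by gcongr; exact min_le_left _ _
      linarith
    · rw [hQ2, ← mul_min_of_nonneg _ _ (by norm_num : (0:ℝ) ≤ 2)]
      apply le_of_eq; ring
  · refine main L hLn hLr le_rfl ?_ ?_
    · rw [← hβ0]; simp; positivity
    · have : min (Real.log 2 / 8 * (k : ℝ) / (β * lam)) (2 * L) ≤ 2 * L := min_le_right _ _
      have := mul_le_mul_of_nonneg_left this (by positivity : 0 ≤ Real.log 2 / 8)
      linarith
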